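/- Let p be an odd prime, q = p^m with m > 1 odd, and D = {x ∈ GF(q)* : Tr(x²)=0}. The code C_D = {(Tr(xd))_{d∈D} : x ∈ GF(q)} over GF(p) has length p^{m-1}-1, dimension m, and exactly three nonzero weights: w_1 = (p-1)(p^{m-2} - p^{(m-3)/2}) with multiplicity (p-1)(p^{m-1}+p^{(m-1)/2})/2, w_2 = (p-1)p^{m-2} with multiplicity p^{m-1}-1, and w_3 = (p-1)(p^{m-2} + p^{(m-3)/2}) with multiplicity (p-1)(p^{m-1}-p^{(m-1)/2})/2. -/

import Mathlib

open Finset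

/-- The quadratic character of a finite field, with complex values. -/
noncomputable def complexQuadraticChar (K : Type*) [Field K] [Fintype K] [DecidableEq K] :
    MulChar K ℂ :=
  (quadraticChar K).ringHomComp (Int.castRingHom ℂ)

section QuadraticGaussSum

variable {K : Type*} [Field K] [Fintype K] [DecidableEq K]

theorem complexQuadraticChar_apply (a : K) :
    complexQuadraticChar K a = (quadraticChar K a : ℂ) := rfl

@[simp]
theorem complexQuadraticChar_zero : complexQuadraticChar K 0 = 0 := by
  simp [complexQuadraticChar_apply]

theorem complexQuadraticChar_ne_one (hK : ringChar K ≠ 2) : complexQuadraticChar K ≠ 1 := by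
  obtain ⟨a, ha⟩ := quadraticChar_exists_neg_one' hK
  refine MulChar.ne_one_iff.mpr ⟨a, ?_⟩
  rw [complexQuadraticChar_apply, ha]
  norm_num

theorem complexQuadraticChar_isQuadratic : (complexQuadraticChar K).IsQuadratic :=
  (quadraticChar_isQuadratic K).comp _

theorem complexQuadraticChar_mul_self {a : K} (ha : a ≠ 0) :
    complexQuadraticChar K a * complexQuadraticChar K a = 1 := by
  rw [complexQuadraticChar_apply, ← Int.cast_mul, ← sq, quadraticChar_sq_one ha, Int.cast_one]

theorem complexQuadraticChar_sq_mul {c : K} (hc : c ≠ 0) (a : K) :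
    complexQuadraticChar K (c ^ 2 * a) = complexQuadraticChar K a := by
  rw [map_mul, map_pow, sq, complexQuadraticChar_mul_self hc, one_mul]

theorem gaussSum_complexQuadraticChar_sq (hK : ringChar K ≠ 2) {ψ : AddChar K ℂ}
    (hψ : ψ.IsPrimitive) :
    gaussSum (complexQuadraticChar K) ψ ^ 2 =
      complexQuadraticChar K (-1) * Fintype.card K :=
  gaussSum_sq (complexQuadraticChar_ne_one hK) complexQuadraticChar_isQuadratic hψ

theorem sum_addChar_sq (hK : ringChar K ≠ 2) {ψ : AddChar K ℂ} (hψ : ψ.IsPrimitive) :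
    ∑ x : K, ψ (x ^ 2) = gaussSum (complexQuadraticChar K) ψ := by
  have hfib : ∑ x : K, ψ (x ^ 2) = ∑ t : K, (complexQuadraticChar K t + 1) * ψ t := by
    rw [← Finset.sum_fiberwise (univ : Finset K) (fun x => x ^ 2) (fun x => ψ (x ^ 2))]
    refine Finset.sum_congr rfl fun t _ => ?_
    rw [Finset.sum_congr rfl (g := fun _ => ψ t)
      (fun x hx => by rw [(Finset.mem_filter.mp hx).2]), Finset.sum_const, nsmul_eq_mul]
    congr 1
    have h := quadraticChar_card_sqrts hK t
    rw [complexQuadraticChar_apply]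
    have h' : (((filter (fun x : K => x ^ 2 = t) univ).card : ℤ)) = quadraticChar K t + 1 := by
      rw [← h]; congr 2; ext x; simp
    exact_mod_cast h'
  have hsum : ∑ t : K, ψ t = 0 := by
    have h := AddChar.sum_mulShift (1 : K) hψ
    simpa using h
  rw [hfib]
  simp only [add_mul, one_mul, Finset.sum_add_distrib, hsum, add_zero, gaussSum]

theorem sum_addChar_mul_sq (hK : ringChar K ≠ 2) {ψ : AddChar K ℂ} (hψ : ψ.IsPrimitive)
    {a : K} (ha : a ≠ 0) :
    ∑ x : K, ψ (a * x ^ 2) =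
      complexQuadraticChar K a * gaussSum (complexQuadraticChar K) ψ := by
  have hprim : (ψ.mulShift a).IsPrimitive := AddChar.IsPrimitive.of_ne_one (hψ ha)
  have h := sum_addChar_sq hK hprim
  simp only [AddChar.mulShift_apply] at h
  rw [h, ← gaussSum_mulShift (complexQuadraticChar K) ψ (Units.mk0 a ha), Units.val_mk0,
    ← mul_assoc, complexQuadraticChar_mul_self ha, one_mul]

theorem sum_addChar_quadratic (hK : ringChar K ≠ 2) {ψ : AddChar K ℂ} (hψ : ψ.IsPrimitive)
    {a : K} (ha : a ≠ 0) (b : K) :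
    ∑ x : K, ψ (a * x ^ 2 + b * x) =
      complexQuadraticChar K a * gaussSum (complexQuadraticChar K) ψ *
        ψ (-(b ^ 2 / (4 * a))) := by
  have h2 : (2 : K) ≠ 0 := Ring.two_ne_zero hK
  rw [← sum_addChar_mul_sq hK hψ ha, Finset.sum_mul,
    ← Equiv.sum_comp (Equiv.addRight (b / (2 * a))) (fun x => ψ (a * x ^ 2) * _)]
  refine Finset.sum_congr rfl fun x _ => ?_
  rw [← AddChar.map_add_eq_mul, Equiv.coe_addRight]
  congr 1
  have h4 : (4 : K) ≠ 0 := by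
    have : (4 : K) = 2 * 2 := by norm_num
    rw [this]; exact mul_ne_zero h2 h2
  field_simp
  ring

end QuadraticGaussSum

section TraceForm

variable {p m : ℕ} [Fact p.Prime] {F : Type*} [Field F] [Algebra (ZMod p) F]

theorem ringChar_ne_two_of_algebra_zmod (hp : Odd p) : ringChar F ≠ 2 := by
  have : CharP F p := charP_of_injective_algebraMap (algebraMap (ZMod p) F).injective p
  rw [ringChar.eq F p]
  rintro rfl
  exact absurd hp (by decide)

theorem finrank_zmod_eq [Fintype F] (hcard : Fintype.card F = p ^ m) :
    Module.finrank (ZMod p) F = m := by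
  have h := Module.card_eq_pow_finrank (K := ZMod p) (V := F)
  rw [ZMod.card, hcard] at h
  exact (Nat.pow_right_injective (Fact.out : p.Prime).two_le h).symm

theorem complexQuadraticChar_algebraMap [Fintype F] [DecidableEq F] (hm : Odd m)
    (hcard : Fintype.card F = p ^ m) (y : ZMod p) :
    complexQuadraticChar F (algebraMap (ZMod p) F y) = complexQuadraticChar (ZMod p) y := by
  rcases eq_or_ne y 0 with rfl | hy
  · simp
  have hy' : algebraMap (ZMod p) F y ≠ 0 := by simpa using hy
  have hiff : IsSquare (algebraMap (ZMod p) F y) ↔ IsSquare y := by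
    refine ⟨fun h => ?_, fun h => h.map _⟩
    have hn := h.map (Algebra.norm (ZMod p))
    rw [Algebra.norm_algebraMap, finrank_zmod_eq hcard] at hn
    obtain ⟨k, rfl⟩ := hm
    rw [pow_succ, pow_mul'] at hn
    obtain ⟨r, hr⟩ := hn
    refine ⟨r / y ^ k, ?_⟩
    field_simp
    rw [sq r, ← hr]
    ring
  rw [complexQuadraticChar_apply, complexQuadraticChar_apply]
  congr 1
  by_cases h : IsSquare y
  · rw [(quadraticChar_one_iff_isSquare hy).mpr h,
      (quadraticChar_one_iff_isSquare hy').mpr (hiff.mpr h)]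
  · rw [quadraticChar_neg_one_iff_not_isSquare.mpr h,
      quadraticChar_neg_one_iff_not_isSquare.mpr (mt hiff.mp h)]

variable (p F) in
/-- The canonical additive character `x ↦ exp (2πi Tr(x) / p)`. -/
noncomputable def traceAddChar : AddChar F ℂ :=
  (ZMod.stdAddChar (N := p)).compAddMonoidHom (Algebra.trace (ZMod p) F).toAddMonoidHom

theorem traceAddChar_apply (x : F) :
    traceAddChar p F x = ZMod.stdAddChar (Algebra.trace (ZMod p) F x) := rfl

theorem traceAddChar_algebraMap_mul (z : ZMod p) (x : F) :
    traceAddChar p F (algebraMap (ZMod p) F z * x) =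
      ZMod.stdAddChar (z * Algebra.trace (ZMod p) F x) := by
  rw [traceAddChar_apply, ← Algebra.smul_def, map_smul, smul_eq_mul]

variable [Fintype F]

theorem traceAddChar_isPrimitive : (traceAddChar p F).IsPrimitive := by
  refine AddChar.IsPrimitive.of_ne_one (AddChar.ne_one_iff.mpr ?_)
  obtain ⟨x, hx⟩ := Algebra.trace_surjective (ZMod p) F 1
  refine ⟨x, fun h => one_ne_zero (α := ZMod p) ?_⟩
  rw [traceAddChar_apply, hx] at h
  exact ZMod.injective_stdAddChar (h.trans (AddChar.map_zero_eq_one _).symm)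

theorem sum_stdAddChar_mul (a : ZMod p) :
    ∑ z : ZMod p, ZMod.stdAddChar (z * a) = if a = 0 then (p : ℂ) else 0 := by
  rw [AddChar.sum_mulShift a (ZMod.isPrimitive_stdAddChar p), ZMod.card]
  split_ifs <;> simp

theorem card_filter_eq_zero_mul {α : Type*} [Fintype α] (f : α → ZMod p) :
    ((univ.filter fun x => f x = 0).card : ℂ) * p =
      ∑ z : ZMod p, ∑ x : α, ZMod.stdAddChar (z * f x) := by
  rw [Finset.sum_comm]
  simp only [sum_stdAddChar_mul]
  rw [← Finset.sum_filter, Finset.sum_const, nsmul_eq_mul]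

theorem card_filter_and_eq_zero_mul {α : Type*} [Fintype α] (f g : α → ZMod p) :
    ((univ.filter fun x => f x = 0 ∧ g x = 0).card : ℂ) * p ^ 2 =
      ∑ y : ZMod p, ∑ z : ZMod p, ∑ x : α,
        ZMod.stdAddChar (y * f x) * ZMod.stdAddChar (z * g x) := by
  have h : ∀ x : α, ∑ y : ZMod p, ∑ z : ZMod p,
      (ZMod.stdAddChar (y * f x) * ZMod.stdAddChar (z * g x) : ℂ) =
        if f x = 0 ∧ g x = 0 then (p : ℂ) ^ 2 else 0 := by
    intro x
    simp only [← Finset.mul_sum, ← Finset.sum_mul, sum_stdAddChar_mul]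
    split_ifs <;> simp_all [sq]
  calc _ = ∑ x : α, if f x = 0 ∧ g x = 0 then (p : ℂ) ^ 2 else 0 := by
        rw [← Finset.sum_filter, Finset.sum_const, nsmul_eq_mul]
    _ = ∑ x : α, ∑ y : ZMod p, ∑ z : ZMod p,
          (ZMod.stdAddChar (y * f x) * ZMod.stdAddChar (z * g x) : ℂ) := by simp only [h]
    _ = _ := by
        rw [Finset.sum_comm]
        exact Finset.sum_congr rfl fun y _ => Finset.sum_comm

theorem card_trace_mul_eq_zero [DecidableEq F] {n : ℕ} (hcard : Fintype.card F = p ^ (n + 1))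
    {x : F} (hx : x ≠ 0) :
    (univ.filter fun b : F => Algebra.trace (ZMod p) F (b * x) = 0).card = p ^ n := by
  have hp0 : (p : ℂ) ≠ 0 := by exact_mod_cast (Fact.out : p.Prime).ne_zero
  have h := card_filter_eq_zero_mul (p := p) fun b : F => Algebra.trace (ZMod p) F (b * x)
  have hz : ∀ z : ZMod p, ∑ b : F, ZMod.stdAddChar (z * Algebra.trace (ZMod p) F (b * x)) =
      if z = 0 then (p : ℂ) ^ (n + 1) else 0 := by
    intro z
    simp only [← traceAddChar_algebraMap_mul, mul_left_comm _ _ x]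
    rw [AddChar.sum_mulShift _ traceAddChar_isPrimitive, hcard]
    by_cases hz : z = 0 <;> simp [hz, hx]
  simp only [hz, Finset.sum_ite_eq', Finset.mem_univ, if_true, pow_succ] at h
  exact_mod_cast mul_right_cancel₀ hp0 h

theorem card_trace_sq_eq_zero {n : ℕ} (hp : Odd p) (hn : Odd (n + 1))
    (hcard : Fintype.card F = p ^ (n + 1)) :
    (univ.filter fun x : F => Algebra.trace (ZMod p) F (x ^ 2) = 0).card = p ^ n := by
  classical
  have hp0 : (p : ℂ) ≠ 0 := by exact_mod_cast (Fact.out : p.Prime).ne_zero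
  have h := card_filter_eq_zero_mul (p := p) fun x : F => Algebra.trace (ZMod p) F (x ^ 2)
  have hz : ∀ z : ZMod p, ∑ x : F, ZMod.stdAddChar (z * Algebra.trace (ZMod p) F (x ^ 2)) =
      (if z = 0 then (p : ℂ) ^ (n + 1) else 0) + complexQuadraticChar (ZMod p) z *
        gaussSum (complexQuadraticChar F) (traceAddChar p F) := by
    intro z
    rcases eq_or_ne z 0 with rfl | hz
    · simp [hcard]
    · simp only [← traceAddChar_algebraMap_mul]
      rw [sum_addChar_mul_sq (ringChar_ne_two_of_algebra_zmod hp) traceAddChar_isPrimitive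
        (by simpa using hz), complexQuadraticChar_algebraMap hn hcard, if_neg hz, zero_add]
  simp only [hz, Finset.sum_add_distrib, ← Finset.sum_mul, Finset.sum_ite_eq', Finset.mem_univ,
    if_true, MulChar.sum_eq_zero_of_ne_one (complexQuadraticChar_ne_one
      (ringChar_ne_two_of_algebra_zmod (F := ZMod p) hp)), zero_mul, add_zero] at h
  rw [pow_succ] at h
  exact_mod_cast mul_right_cancel₀ hp0 h

theorem sum_sum_traceAddChar {n : ℕ} [DecidableEq F] (hp : Odd p) (hn : Odd n)
    (hcard : Fintype.card F = p ^ n) {b : F} (hb : b ≠ 0) (y : ZMod p) :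
    ∑ z : ZMod p, ∑ x : F, ZMod.stdAddChar (y * Algebra.trace (ZMod p) F (x ^ 2)) *
        ZMod.stdAddChar (z * Algebra.trace (ZMod p) F (b * x)) =
      (if y = 0 then (p : ℂ) ^ n else 0) + complexQuadraticChar (ZMod p) y *
        gaussSum (complexQuadraticChar F) (traceAddChar p F) *
        ∑ z : ZMod p, ZMod.stdAddChar (-(Algebra.trace (ZMod p) F (b ^ 2) / (4 * y)) * z ^ 2) := by
  rcases eq_or_ne y 0 with rfl | hy
  · have hz : ∀ z : ZMod p, ∑ x : F, ZMod.stdAddChar (z * Algebra.trace (ZMod p) F (b * x)) =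
        if z = 0 then (p : ℂ) ^ n else 0 := by
      intro z
      simp only [← traceAddChar_algebraMap_mul, mul_comm b, mul_left_comm (algebraMap (ZMod p) F z)]
      rw [AddChar.sum_mulShift _ traceAddChar_isPrimitive, hcard]
      by_cases hz : z = 0 <;> simp [hz, hb]
    simp [hz]
  · rw [if_neg hy, zero_add, Finset.mul_sum]
    refine Finset.sum_congr rfl fun z _ => ?_
    simp only [← traceAddChar_algebraMap_mul, ← AddChar.map_add_eq_mul, ← mul_assoc]
    rw [sum_addChar_quadratic (ringChar_ne_two_of_algebra_zmod hp) traceAddChar_isPrimitive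
      (by simpa using hy), complexQuadraticChar_algebraMap hn hcard]
    congr 1
    have : -((algebraMap (ZMod p) F z * b) ^ 2 / (4 * algebraMap (ZMod p) F y)) =
        algebraMap (ZMod p) F (-(z ^ 2 / (4 * y))) * b ^ 2 := by
      simp only [map_neg, map_div₀, map_mul, map_pow, map_ofNat]
      ring
    rw [this, traceAddChar_algebraMap_mul]
    congr 1
    ring

theorem card_trace_sq_and_trace_mul_of_eq_zero {n : ℕ} (hp : Odd p) (hn : Odd (n + 2))
    (hcard : Fintype.card F = p ^ (n + 2)) {b : F} (hb : b ≠ 0)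
    (hb2 : Algebra.trace (ZMod p) F (b ^ 2) = 0) :
    (univ.filter fun x : F => Algebra.trace (ZMod p) F (x ^ 2) = 0 ∧
      Algebra.trace (ZMod p) F (b * x) = 0).card = p ^ n := by
  classical
  have hp0 : (p : ℂ) ≠ 0 := by exact_mod_cast (Fact.out : p.Prime).ne_zero
  have h := card_filter_and_eq_zero_mul (p := p) (fun x : F => Algebra.trace (ZMod p) F (x ^ 2))
    fun x => Algebra.trace (ZMod p) F (b * x)
  simp only [sum_sum_traceAddChar hp hn hcard hb, hb2, zero_div, neg_zero, zero_mul,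
    AddChar.map_zero_eq_one, Finset.sum_add_distrib, ← Finset.sum_mul, Finset.sum_ite_eq',
    Finset.mem_univ, if_true, pow_add, MulChar.sum_eq_zero_of_ne_one (complexQuadraticChar_ne_one
      (ringChar_ne_two_of_algebra_zmod (F := ZMod p) hp)), zero_mul, add_zero] at h
  exact_mod_cast mul_right_cancel₀ (pow_ne_zero 2 hp0) h

theorem card_trace_sq_and_trace_mul_of_ne_zero {j : ℕ} (hp : Odd p)
    (hcard : Fintype.card F = p ^ (2 * j + 3)) {b : F}
    (hb2 : Algebra.trace (ZMod p) F (b ^ 2) ≠ 0) :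
    ((univ.filter fun x : F => Algebra.trace (ZMod p) F (x ^ 2) = 0 ∧
      Algebra.trace (ZMod p) F (b * x) = 0).card : ℤ) = p ^ (2 * j + 1) + (p - 1) * p ^ j ∨
    ((univ.filter fun x : F => Algebra.trace (ZMod p) F (x ^ 2) = 0 ∧
      Algebra.trace (ZMod p) F (b * x) = 0).card : ℤ) = p ^ (2 * j + 1) - (p - 1) * p ^ j := by
  classical
  have hp0 : (p : ℂ) ≠ 0 := by exact_mod_cast (Fact.out : p.Prime).ne_zero
  have hn : Odd (2 * j + 3) := ⟨j + 1, by ring⟩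
  have hb : b ≠ 0 := by rintro rfl; simp at hb2
  have hF : ringChar F ≠ 2 := ringChar_ne_two_of_algebra_zmod hp
  have hZ : ringChar (ZMod p) ≠ 2 := ringChar_ne_two_of_algebra_zmod (F := ZMod p) hp
  have h2 : (2 : ZMod p) ≠ 0 := Ring.two_ne_zero hZ
  have h4 : (4 : ZMod p) ≠ 0 := by
    have : (4 : ZMod p) = 2 * 2 := by norm_num
    rw [this]; exact mul_ne_zero h2 h2
  have h := card_filter_and_eq_zero_mul (p := p) (fun x : F => Algebra.trace (ZMod p) F (x ^ 2))
    fun x => Algebra.trace (ZMod p) F (b * x)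
  simp only [sum_sum_traceAddChar hp hn hcard hb] at h
  set c := Algebra.trace (ZMod p) F (b ^ 2)
  set N := (univ.filter fun x : F => Algebra.trace (ZMod p) F (x ^ 2) = 0 ∧
      Algebra.trace (ZMod p) F (b * x) = 0).card
  set G := gaussSum (complexQuadraticChar F) (traceAddChar p F) with hG
  set g := gaussSum (complexQuadraticChar (ZMod p)) ZMod.stdAddChar with hg
  set E := complexQuadraticChar (ZMod p) (-c) * G * g with hE
  have hy : ∀ y : ZMod p, complexQuadraticChar (ZMod p) y * G *
      ∑ z : ZMod p, ZMod.stdAddChar (-(c / (4 * y)) * z ^ 2) =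
        E - if y = 0 then E else 0 := by
    intro y
    rcases eq_or_ne y 0 with rfl | hy
    · simp
    · rw [sum_addChar_mul_sq hZ (ZMod.isPrimitive_stdAddChar p)
        (neg_ne_zero.mpr (div_ne_zero hb2 (mul_ne_zero h4 hy))), if_neg hy, sub_zero, hE, ← hg]
      have : -(c / (4 * y)) = ((2 * y)⁻¹) ^ 2 * (y * -c) := by
        field_simp
        norm_num
      rw [this, complexQuadraticChar_sq_mul (inv_ne_zero (mul_ne_zero h2 hy)), map_mul]
      linear_combination (complexQuadraticChar (ZMod p) (-c) * G * g) *
        complexQuadraticChar_mul_self hy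
  simp only [hy, Finset.sum_add_distrib, Finset.sum_sub_distrib, Finset.sum_ite_eq',
    Finset.mem_univ, if_true, Finset.sum_const, Finset.card_univ, ZMod.card, nsmul_eq_mul] at h
  have hsq : E ^ 2 = ((p : ℂ) ^ (j + 2)) ^ 2 := by
    have h1 : G ^ 2 = _ := gaussSum_complexQuadraticChar_sq hF traceAddChar_isPrimitive
    have h2 : g ^ 2 = _ :=
      gaussSum_complexQuadraticChar_sq hZ (ZMod.isPrimitive_stdAddChar p)
    have h3 : complexQuadraticChar F (-1) = complexQuadraticChar (ZMod p) (-1) := by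
      rw [← complexQuadraticChar_algebraMap hn hcard]; simp
    have h5 := complexQuadraticChar_mul_self (neg_ne_zero.mpr hb2)
    have h6 := complexQuadraticChar_mul_self (K := ZMod p) (neg_ne_zero.mpr one_ne_zero)
    rw [h3, hcard] at h1
    rw [ZMod.card] at h2
    rw [hE, mul_pow, mul_pow, sq (complexQuadraticChar _ _), h5, h1, h2]
    push_cast
    linear_combination (p : ℂ) ^ (2 * j + 4) * h6
  rcases sq_eq_sq_iff_eq_or_eq_neg.mp hsq with hE' | hE'
  · left
    have : (N : ℂ) = p ^ (2 * j + 1) + (p - 1) * p ^ j := by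
      refine mul_right_cancel₀ (pow_ne_zero 2 hp0) (h.trans ?_)
      rw [hE']; ring
    exact_mod_cast this
  · right
    have : (N : ℂ) = p ^ (2 * j + 1) - (p - 1) * p ^ j := by
      refine mul_right_cancel₀ (pow_ne_zero 2 hp0) (h.trans ?_)
      rw [hE']; ring
    exact_mod_cast this

theorem ncard_trace_ne_zero_add_card (b : F) :
    {x ∈ {x : F | x ≠ 0 ∧ Algebra.trace (ZMod p) F (x ^ 2) = 0} |
        Algebra.trace (ZMod p) F (b * x) ≠ 0}.ncard +
      (univ.filter fun x : F => Algebra.trace (ZMod p) F (x ^ 2) = 0 ∧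
        Algebra.trace (ZMod p) F (b * x) = 0).card =
      (univ.filter fun x : F => Algebra.trace (ZMod p) F (x ^ 2) = 0).card := by
  classical
  rw [← Finset.card_filter_add_card_filter_not (s := univ.filter fun x : F =>
    Algebra.trace (ZMod p) F (x ^ 2) = 0) (fun x => Algebra.trace (ZMod p) F (b * x) = 0),
    add_comm, Finset.filter_filter, Finset.filter_filter, ← Set.ncard_coe_finset (filter
      (fun x : F => Algebra.trace (ZMod p) F (x ^ 2) = 0 ∧
        ¬Algebra.trace (ZMod p) F (b * x) = 0) univ)]
  congr 2
  ext x
  simp only [Set.mem_ofPred_eq, Finset.coe_filter, Finset.mem_univ, true_and]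
  constructor
  · rintro ⟨⟨_, h⟩, h'⟩
    exact ⟨h, h'⟩
  · rintro ⟨h, h'⟩
    refine ⟨⟨?_, h⟩, h'⟩
    rintro rfl
    simp at h'

theorem ncard_ne_zero_and_trace_sq {n : ℕ} (hp : Odd p) (hn : Odd (n + 1))
    (hcard : Fintype.card F = p ^ (n + 1)) :
    {x : F | x ≠ 0 ∧ Algebra.trace (ZMod p) F (x ^ 2) = 0}.ncard = p ^ n - 1 := by
  classical
  have h0 : (0 : F) ∈ univ.filter fun x : F => Algebra.trace (ZMod p) F (x ^ 2) = 0 := by simp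
  rw [← card_trace_sq_eq_zero hp hn hcard, ← Finset.card_erase_of_mem h0,
    ← Set.ncard_coe_finset]
  congr 1
  ext x
  simp [and_comm]

theorem sum_ncard_trace_ne_zero {n : ℕ} (hp : Odd p) (hn : Odd (n + 1))
    (hcard : Fintype.card F = p ^ (n + 1)) :
    ∑ b : F, ({x ∈ {x : F | x ≠ 0 ∧ Algebra.trace (ZMod p) F (x ^ 2) = 0} |
        Algebra.trace (ZMod p) F (b * x) ≠ 0}.ncard : ℤ) =
      (p ^ n - 1) * (p ^ (n + 1) - p ^ n) := by
  classical
  set D : Finset F := univ.filter fun x => x ≠ 0 ∧ Algebra.trace (ZMod p) F (x ^ 2) = 0 with hD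
  have hDcard : (D.card : ℤ) = p ^ n - 1 := by
    have h := ncard_ne_zero_and_trace_sq hp hn hcard
    rw [show {x : F | x ≠ 0 ∧ Algebra.trace (ZMod p) F (x ^ 2) = 0} = ↑D by ext; simp [hD],
      Set.ncard_coe_finset] at h
    rw [h, Nat.cast_sub (Nat.one_le_pow _ _ (Fact.out : p.Prime).pos)]
    simp
  have hrow : ∀ b : F, {x ∈ {x : F | x ≠ 0 ∧ Algebra.trace (ZMod p) F (x ^ 2) = 0} |
      Algebra.trace (ZMod p) F (b * x) ≠ 0}.ncard =
        (D.bipartiteAbove (fun b x => Algebra.trace (ZMod p) F (b * x) ≠ 0) b).card := by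
    intro b
    rw [← Set.ncard_coe_finset]
    congr 1
    ext x
    simp [hD, Finset.bipartiteAbove]
  simp only [hrow]
  rw [← Nat.cast_sum, Finset.sum_card_bipartiteAbove_eq_sum_card_bipartiteBelow, Nat.cast_sum,
    ← hDcard, ← nsmul_eq_mul, ← Finset.sum_const]
  refine Finset.sum_congr rfl fun x hx => ?_
  have hx0 : x ≠ 0 := (Finset.mem_filter.mp hx).2.1
  have h := Finset.card_filter_add_card_filter_not (s := (univ : Finset F))
    (fun b => Algebra.trace (ZMod p) F (b * x) = 0)
  rw [card_trace_mul_eq_zero hcard hx0, Finset.card_univ, hcard] at h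
  rw [Finset.bipartiteBelow]
  have h' : ((p ^ n + (filter (fun b => ¬Algebra.trace (ZMod p) F (b * x) = 0) univ).card : ℕ) : ℤ)
    = (p ^ (n + 1) : ℕ) := congrArg _ h
  push_cast at h'
  linarith

end TraceForm

theorem multiplicities_of_moments {p k n₁ n₃ : ℤ} (hp : p - 1 ≠ 0) (hk : k ≠ 0)
    (htotal : n₁ + (p ^ 2 * k ^ 2 - 1) + n₃ + 1 = p ^ 3 * k ^ 2)
    (hmoment : (p - 1) * (p * k ^ 2 - k) * n₁ + (p - 1) * (p * k ^ 2) * (p ^ 2 * k ^ 2 - 1) +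
      (p - 1) * (p * k ^ 2 + k) * n₃ = (p ^ 2 * k ^ 2 - 1) * (p ^ 3 * k ^ 2 - p ^ 2 * k ^ 2)) :
    n₁ * 2 = (p - 1) * (p ^ 2 * k ^ 2 + p * k) ∧ n₃ * 2 = (p - 1) * (p ^ 2 * k ^ 2 - p * k) := by
  have hdiff : n₁ - n₃ = p * k * (p - 1) := by
    refine mul_left_cancel₀ (mul_ne_zero hp hk) ?_
    linear_combination (p - 1) * (p * k ^ 2) * htotal - hmoment
  constructor
  · linear_combination htotal + hdiff
  · linear_combination htotal - hdiff

theorem stmt_8 (p m : ℕ) [Fact p.Prime] (hp : Odd p) (hm : Odd m) (hm1 : 1 < m)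
    (F : Type*) [Field F] [Fintype F] [Algebra (ZMod p) F]
    (hcard : Fintype.card F = p ^ m)
    (Tr : F → ZMod p) (hTr : Tr = Algebra.trace (ZMod p) F)
    (D : Set F) (hD : D = {x : F | x ≠ 0 ∧ Tr (x ^ 2) = 0})
    -- Hamming weight of the codeword c_b = (Tr (b d))_{d ∈ D}
    (wt : F → ℤ) (hwt : ∀ b, wt b = Set.ncard {x ∈ D | Tr (b * x) ≠ 0})
    (w₁ w₂ w₃ : ℤ)
    (hw₁ : w₁ = ((p : ℤ) - 1) * ((p : ℤ) ^ (m - 2) - (p : ℤ) ^ ((m - 3) / 2)))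
    (hw₂ : w₂ = ((p : ℤ) - 1) * (p : ℤ) ^ (m - 2))
    (hw₃ : w₃ = ((p : ℤ) - 1) * ((p : ℤ) ^ (m - 2) + (p : ℤ) ^ ((m - 3) / 2))) :
    -- length
    D.ncard = p ^ (m - 1) - 1 ∧
    -- dimension m: the map b ↦ (Tr (b d))_{d ∈ D} is injective on GF(q)
    Function.Injective (fun b : F => fun d : D => Tr (b * (d : F))) ∧
    -- exactly three nonzero weights
    {w : ℤ | ∃ b : F, b ≠ 0 ∧ wt b = w} = {w₁, w₂, w₃} ∧
    -- multiplicities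
    (Set.ncard {b : F | wt b = w₁} : ℤ) =
      ((p : ℤ) - 1) * ((p : ℤ) ^ (m - 1) + (p : ℤ) ^ ((m - 1) / 2)) / 2 ∧
    (Set.ncard {b : F | b ≠ 0 ∧ wt b = w₂} : ℤ) = (p : ℤ) ^ (m - 1) - 1 ∧
    (Set.ncard {b : F | wt b = w₃} : ℤ) =
      ((p : ℤ) - 1) * ((p : ℤ) ^ (m - 1) - (p : ℤ) ^ ((m - 1) / 2)) / 2 := by
  classical
  obtain ⟨j, rfl⟩ : ∃ j, m = 2 * j + 3 := by
    obtain ⟨k, rfl⟩ := hm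
    exact ⟨k - 1, by omega⟩
  subst hTr hD
  have e1 : 2 * j + 3 - 1 = 2 * j + 2 := by omega
  have e2 : 2 * j + 3 - 2 = 2 * j + 1 := by omega
  have e3 : (2 * j + 3 - 3) / 2 = j := by omega
  have e4 : (2 * j + 2) / 2 = j + 1 := by omega
  rw [e2, e3] at hw₁ hw₃
  rw [e2] at hw₂
  rw [e1, e4]
  have hp3 : 3 ≤ (p : ℤ) := by
    have := (Fact.out : p.Prime).two_le
    obtain ⟨k, hk⟩ := hp
    omega
  have hk1 : 1 ≤ (p : ℤ) ^ j := one_le_pow₀ (by linarith)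
  have hD := ncard_ne_zero_and_trace_sq (n := 2 * j + 2) hp hm hcard
  have hwt_add : ∀ b : F, wt b + ((univ.filter fun x : F =>
      Algebra.trace (ZMod p) F (x ^ 2) = 0 ∧ Algebra.trace (ZMod p) F (b * x) = 0).card : ℤ) =
        p ^ (2 * j + 2) := by
    intro b
    rw [hwt]
    have h := ncard_trace_ne_zero_add_card (p := p) b
    rw [card_trace_sq_eq_zero (n := 2 * j + 2) hp hm hcard] at h
    exact_mod_cast h
  have hpow : (p : ℤ) ^ (2 * j + 1) = p * (p ^ j) ^ 2 := by ring
  have hpow2 : (p : ℤ) ^ (2 * j + 2) = p ^ 2 * (p ^ j) ^ 2 := by ring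
  have hpow3 : (p : ℤ) ^ (2 * j + 3) = p ^ 3 * (p ^ j) ^ 2 := by ring
  have hpow1 : (p : ℤ) ^ (j + 1) = p * p ^ j := by ring
  have hzero : wt 0 = 0 := by rw [hwt]; simp
  have htwo : ∀ b : F, b ≠ 0 → Algebra.trace (ZMod p) F (b ^ 2) = 0 → wt b = w₂ := by
    intro b hb hb2
    have h := hwt_add b
    rw [card_trace_sq_and_trace_mul_of_eq_zero hp hm hcard hb hb2] at h
    rw [hw₂]
    push_cast at h
    linear_combination h
  have hone_three : ∀ b : F, Algebra.trace (ZMod p) F (b ^ 2) ≠ 0 → wt b = w₁ ∨ wt b = w₃ := by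
    intro b hb2
    have h := hwt_add b
    rcases card_trace_sq_and_trace_mul_of_ne_zero hp hcard hb2 with hc | hc <;> rw [hc] at h
    · left
      rw [hw₁]
      linear_combination h
    · right
      rw [hw₃]
      linear_combination h
  rw [hpow] at hw₁ hw₂ hw₃
  set k : ℤ := (p : ℤ) ^ j with hk
  clear_value k
  have hpk : k < p * k ^ 2 := by nlinarith
  have h1pos : 0 < w₁ := by rw [hw₁]; exact mul_pos (by linarith) (by linarith)
  have h12 : w₁ < w₂ := by rw [hw₁, hw₂]; nlinarith
  have h23 : w₂ < w₃ := by rw [hw₂, hw₃]; nlinarith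
  have hne : ∀ b : F, b ≠ 0 → 0 < wt b := by
    intro b hb
    by_cases hb2 : Algebra.trace (ZMod p) F (b ^ 2) = 0
    · rw [htwo b hb hb2]; linarith
    · rcases hone_three b hb2 with h | h <;> rw [h] <;> linarith
  have hset2 : {b : F | b ≠ 0 ∧ wt b = w₂} =
      {b : F | b ≠ 0 ∧ Algebra.trace (ZMod p) F (b ^ 2) = 0} := by
    ext b
    refine and_congr_right fun hb => ⟨fun h => ?_, htwo b hb⟩
    by_contra hb2
    rcases hone_three b hb2 with h' | h' <;> linarith
  have hn2 : ({b : F | b ≠ 0 ∧ wt b = w₂}.ncard : ℤ) = p ^ 2 * k ^ 2 - 1 := by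
    rw [hset2, hD, Nat.cast_sub (Nat.one_le_pow _ _ (Fact.out : p.Prime).pos)]
    push_cast
    rw [hpow2]
  have hcount : ∀ (P : F → Prop) [DecidablePred P],
      ∑ b : F, (if P b then (1 : ℤ) else 0) = {b | P b}.ncard := by
    intro P _
    rw [Finset.sum_boole, ← Set.ncard_coe_finset]
    simp
  have hcases : ∀ b : F, (b = 0 ∧ wt b = 0) ∨ (b ≠ 0 ∧ (wt b = w₁ ∨ wt b = w₂ ∨ wt b = w₃)) := by
    intro b
    by_cases hb : b = 0
    · left; exact ⟨hb, hb ▸ hzero⟩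
    · right
      refine ⟨hb, ?_⟩
      by_cases hb2 : Algebra.trace (ZMod p) F (b ^ 2) = 0
      · exact Or.inr (Or.inl (htwo b hb hb2))
      · rcases hone_three b hb2 with h | h <;> simp [h]
  have htotal : ({b : F | wt b = w₁}.ncard : ℤ) + {b : F | b ≠ 0 ∧ wt b = w₂}.ncard +
      {b : F | wt b = w₃}.ncard + 1 = p ^ 3 * k ^ 2 := by
    have h : ∀ b : F, (if wt b = w₁ then (1 : ℤ) else 0) + (if b ≠ 0 ∧ wt b = w₂ then 1 else 0) +
        (if wt b = w₃ then 1 else 0) + (if b = 0 then 1 else 0) = 1 := by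
      intro b
      rcases hcases b with ⟨hb, h⟩ | ⟨hb, h | h | h⟩ <;>
        simp [hb, h, hzero, h1pos.ne, h12.ne, h12.ne', h23.ne, h23.ne', (h12.trans h23).ne,
          (h12.trans h23).ne', (h1pos.trans (h12.trans h23)).ne]
    have hs := Finset.sum_congr (rfl : (univ : Finset F) = univ) fun b _ => h b
    simp only [Finset.sum_add_distrib, hcount, Finset.sum_const, Finset.card_univ, hcard] at hs
    simp only [Set.ofPred_eq_eq_singleton, Set.ncard_singleton] at hs
    push_cast at hs
    rw [hs, ← hpow3]
    simp
  have hmoment : w₁ * {b : F | wt b = w₁}.ncard + w₂ * {b : F | b ≠ 0 ∧ wt b = w₂}.ncard +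
      w₃ * {b : F | wt b = w₃}.ncard =
        (p ^ 2 * k ^ 2 - 1) * (p ^ 3 * k ^ 2 - p ^ 2 * k ^ 2) := by
    have h : ∀ b : F, w₁ * (if wt b = w₁ then (1 : ℤ) else 0) +
        w₂ * (if b ≠ 0 ∧ wt b = w₂ then 1 else 0) + w₃ * (if wt b = w₃ then 1 else 0) = wt b := by
      intro b
      rcases hcases b with ⟨hb, h⟩ | ⟨hb, h | h | h⟩ <;>
        simp [hb, h, hzero, h1pos.ne, h12.ne, h12.ne', h23.ne, h23.ne', (h12.trans h23).ne,
          (h12.trans h23).ne', (h1pos.trans (h12.trans h23)).ne]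
    have hs := Finset.sum_congr (rfl : (univ : Finset F) = univ) fun b _ => h b
    simp only [Finset.sum_add_distrib, ← Finset.mul_sum, hcount] at hs
    rw [hs, Finset.sum_congr rfl fun b _ => hwt b,
      sum_ncard_trace_ne_zero (n := 2 * j + 2) hp hm hcard, hpow2, hpow3]
  rw [hn2] at htotal hmoment
  obtain ⟨hn1, hn3⟩ := multiplicities_of_moments (p := p) (k := k)
    (by linarith only [hp3]) (by linarith only [hk1]) htotal
    (by rw [← hw₁, ← hw₂, ← hw₃]; exact hmoment)
  have hex : ∀ w : ℤ, 0 < w → 0 < ({b : F | wt b = w}.ncard : ℤ) → ∃ b : F, b ≠ 0 ∧ wt b = w := by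
    intro w hw h
    obtain ⟨b, hb⟩ := Set.nonempty_of_ncard_ne_zero (s := {b : F | wt b = w})
      (Nat.cast_pos.mp h).ne'
    refine ⟨b, ?_, hb⟩
    rintro rfl
    exact hw.ne (hzero.symm.trans hb)
  have hpk0 : 1 < (p : ℤ) * k := by nlinarith only [hp3, hk1]
  have hpk2 : (p : ℤ) * k < p ^ 2 * k ^ 2 := by nlinarith only [hpk0]
  have hpos₁ : 0 < ((p : ℤ) - 1) * (p ^ 2 * k ^ 2 + p * k) :=
    mul_pos (by linarith only [hp3]) (by linarith only [hpk0, hpk2])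
  have hpos₃ : 0 < ((p : ℤ) - 1) * (p ^ 2 * k ^ 2 - p * k) :=
    mul_pos (by linarith only [hp3]) (by linarith only [hpk2])
  refine ⟨hD, ?_, ?_, ?_, ?_, ?_⟩
  · intro b c hbc
    by_contra hne'
    refine (hne (b - c) (sub_ne_zero.mpr hne')).ne' ?_
    rw [hwt, Nat.cast_eq_zero, Set.ncard_eq_zero]
    ext x
    simp only [Set.mem_ofPred_eq, Set.mem_empty_iff_false, iff_false, not_and, not_not]
    intro hx
    have h := congrFun hbc ⟨x, hx⟩
    simp only at h
    rw [sub_mul, map_sub, h, sub_self]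
  · ext w
    simp only [Set.mem_ofPred_eq, Set.mem_insert_iff, Set.mem_singleton_iff]
    constructor
    · rintro ⟨b, hb, rfl⟩
      rcases hcases b with ⟨hb', _⟩ | ⟨_, h⟩
      · exact absurd hb' hb
      · exact h
    · rintro (rfl | rfl | rfl)
      · exact hex _ h1pos (by linarith only [hn1, hpos₁])
      · obtain ⟨b, hb⟩ := Set.nonempty_of_ncard_ne_zero
          (s := {b : F | b ≠ 0 ∧ wt b = w}) (by
            have : ({b : F | b ≠ 0 ∧ wt b = w}.ncard : ℤ) ≠ 0 := by
              rw [hn2]; linarith only [hpk0, hpk2]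
            exact_mod_cast this)
        exact ⟨b, hb⟩
      · exact hex _ (by linarith only [h1pos, h12, h23]) (by linarith only [hn3, hpos₃])
  · rw [hpow2, hpow1]
    exact (Int.ediv_eq_of_eq_mul_left two_ne_zero hn1.symm).symm
  · rw [hn2, hpow2]
  · rw [hpow2, hpow1]
    exact (Int.ediv_eq_of_eq_mul_left two_ne_zero hn3.symm).symm
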